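/- arXiv:1904.01714 — 3 statements merged into one kernel-verified Lean document; each statement's English description precedes it below -/
import Mathlib

section
/- Let p be a prime and α₁,...,α_N a finite sequence in ℤ_p. Define f : ℤ_p × ℤ_p → ℝ by f(x,y) = #{n ≤ N : α_n ∈ D(x,|y|_p)}/N − |y|_p. Then the discrepancy D_N of the sequence satisfies D_N⁴ ≤ C₁(p) · ∬_{ℤ_p×ℤ_p} |f(x,y)|² dμ(x) dμ(y), where C₁(p) is a constant depending only on p (one may take C₁(p) = p⁹/(p−1)³). -/
open MeasureTheory Filter Finset
open scoped Classical

noncomputable section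

/-- The Prüfer `p`-group `ℤ(p^∞)`: the set of all `p`-power roots of unity in `ℂ`
(a multiplicative group). -/
def prufer (p : ℕ) : Set ℂ := {z : ℂ | ∃ n : ℕ, z ^ p ^ n = 1}

/-- For a `p`-power root of unity `ζ` of order `p^j` and `x ∈ ℤ_p` with canonical expansion
`x = a₀ + a₁ p + a₂ p² + ...`, this is `ζ^x := ζ^(a₀ + a₁ p + ... + a_{j-1} p^{j-1})`.
(Here `x.appr n = a₀ + a₁ p + ... + a_{n-1} p^{n-1}`; since `orderOf ζ = p^j ≥ j`, the
exponent `x.appr (orderOf ζ)` is congruent to the truncation `a₀ + ... + a_{j-1} p^{j-1}`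
modulo `p^j = orderOf ζ`, so this agrees with the paper's definition.) -/
def pruferChar (p : ℕ) [Fact p.Prime] (ζ : ℂ) (x : ℤ_[p]) : ℂ :=
  ζ ^ (x.appr (orderOf ζ))

/-- The discrepancy `D_N` of the finite sequence `α 1, ..., α N` in `ℤ_p`:
`D_N = sup_{a ∈ ℤ_p, k ∈ ℕ} | #{1 ≤ n ≤ N : αₙ ∈ D(a, 1/p^k)} / N - 1/p^k |`,
where `D(a, 1/p^k) = {z : |z - a|_p ≤ p^{-k}}`. -/
def disc (p : ℕ) [Fact p.Prime] (N : ℕ) (α : ℕ → ℤ_[p]) : ℝ :=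
  ⨆ (a : ℤ_[p]) (k : ℕ),
    |(((Finset.Icc 1 N).filter fun n => ‖α n - a‖ ≤ (p : ℝ) ^ (-(k : ℤ))).card : ℝ) / N
      - (p : ℝ) ^ (-(k : ℤ))|

/-- The local discrepancy function `f(x, y) = #{1 ≤ n ≤ N : αₙ ∈ D(x, |y|_p)} / N - |y|_p`. -/
def discFun (p : ℕ) [Fact p.Prime] (N : ℕ) (α : ℕ → ℤ_[p]) (x y : ℤ_[p]) : ℝ :=
  (((Finset.Icc 1 N).filter fun n => ‖α n - x‖ ≤ ‖y‖).card : ℝ) / N - ‖y‖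

/-- A sequence `α` is equidistributed in `ℤ_p` if for every disc `D(a, 1/p^k)` the proportion
of the first `N` terms lying in the disc tends to `1/p^k`. -/
def Equidistributed (p : ℕ) [Fact p.Prime] (α : ℕ → ℤ_[p]) : Prop :=
  ∀ (a : ℤ_[p]) (k : ℕ),
    Tendsto (fun N : ℕ =>
        |(((Finset.Icc 1 N).filter fun n => ‖α n - a‖ ≤ (p : ℝ) ^ (-(k : ℤ))).card : ℝ) / N
          - (p : ℝ) ^ (-(k : ℤ))|)
      atTop (nhds 0)

instance (p : ℕ) [Fact p.Prime] : MeasurableSpace ℤ_[p] := borel _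
instance (p : ℕ) [Fact p.Prime] : BorelSpace ℤ_[p] := ⟨rfl⟩

/-- If `c` is antitone with values in `[0, 1]`, then a large deviation of `c k` from `q ^ k`
forces a comparable deviation of `c j` from `q ^ j` at some scale `q ^ j` of that size. -/
lemma exists_sq_abs_sub_pow_le {q : ℝ} (hq0 : 0 < q) (hq1 : q < 1) {c : ℕ → ℝ} (hc : Antitone c)
    (hc0 : ∀ j, 0 ≤ c j) (hc1 : ∀ j, c j ≤ 1) (k : ℕ) :
    ∃ j, q * |c k - q ^ k| ^ 2 ≤ 4 * (q ^ j * |c j - q ^ j|) := by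
  have hqk : 0 < q ^ k := pow_pos hq0 k
  by_cases h : q * |c k - q ^ k| ≤ 4 * q ^ k
  · refine ⟨k, ?_⟩
    nlinarith [mul_le_mul_of_nonneg_right h (abs_nonneg (c k - q ^ k))]
  push Not at h
  have hpos : 0 < c k - q ^ k := by
    by_contra! hneg
    rw [abs_of_nonpos hneg] at h
    nlinarith [hc0 k]
  rw [abs_of_pos hpos] at h ⊢
  set d := c k - q ^ k with hd
  have hd1 : d ≤ 1 := by linarith [hc1 k]
  obtain ⟨n, hn1, hn2⟩ := exists_nat_pow_near_of_lt_one (x := d / 2) (by linarith)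
    (by linarith) hq0 hq1
  have hlt : q ^ k < q ^ (n + 1) := by
    rw [pow_succ]
    nlinarith
  have hj : n + 1 ≤ k := ((pow_lt_pow_iff_right_of_lt_one₀ hq0 hq1).1 hlt).le
  have hdev : d / 2 ≤ c (n + 1) - q ^ (n + 1) := by linarith [hc hj]
  refine ⟨n + 1, ?_⟩
  rw [abs_of_nonneg (by linarith)]
  have hscale : q * (d / 2) ≤ q ^ (n + 1) := by
    rw [pow_succ, mul_comm]
    gcongr
  have hprod : q * (d / 2) * (d / 2) ≤ q ^ (n + 1) * (c (n + 1) - q ^ (n + 1)) := by gcongr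
  linarith

section HaarMeasure

variable {p : ℕ} [Fact p.Prime] (μ : Measure ℤ_[p]) [μ.IsAddHaarMeasure] [IsProbabilityMeasure μ]

lemma measureReal_closedBall_zero (k : ℕ) :
    μ.real (Metric.closedBall 0 ((p : ℝ)⁻¹ ^ k)) = (p : ℝ)⁻¹ ^ k := by
  have hp : p ≠ 0 := (Fact.out : p.Prime).ne_zero
  have : NeZero (p ^ k) := ⟨pow_ne_zero k hp⟩
  let H : AddSubgroup ℤ_[p] := (PadicInt.toZModPow (p := p) k).toAddMonoidHom.ker
  have hH : (H : Set ℤ_[p]) = Metric.closedBall 0 ((p : ℝ)⁻¹ ^ k) := by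
    ext x
    have h := PadicInt.norm_le_pow_iff_mem_span_pow x k
    rw [← PadicInt.ker_toZModPow, RingHom.mem_ker, zpow_neg, zpow_natCast, ← inv_pow] at h
    rw [mem_closedBall_zero_iff, h]
    rfl
  have hindex : H.index = p ^ k := by
    rw [AddSubgroup.index_ker, AddMonoidHom.range_eq_top.2
      (ZMod.ringHom_surjective (PadicInt.toZModPow (p := p) k)), AddSubgroup.card_top,
      Nat.card_zmod]
  have : H.FiniteIndex := ⟨by rw [hindex]; exact pow_ne_zero k hp⟩
  have hmul := H.index_mul_measure (hH ▸ Metric.isClosed_closedBall.measurableSet) μ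
  rw [hindex, hH, measure_univ] at hmul
  have hreal := congrArg ENNReal.toReal hmul
  rw [ENNReal.toReal_mul, ENNReal.toReal_natCast, ENNReal.toReal_one, Nat.cast_pow] at hreal
  exact (eq_inv_of_mul_eq_one_right hreal).trans (inv_pow _ _).symm

lemma measureReal_closedBall (a : ℤ_[p]) (k : ℕ) :
    μ.real (Metric.closedBall a ((p : ℝ)⁻¹ ^ k)) = (p : ℝ)⁻¹ ^ k := by
  have hpre : Metric.closedBall a ((p : ℝ)⁻¹ ^ k) =
      (fun x => -a + x) ⁻¹' Metric.closedBall 0 ((p : ℝ)⁻¹ ^ k) := by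
    ext x
    simp [dist_eq_norm, neg_add_eq_sub]
  rw [hpre, Measure.real, measure_preimage_add]
  exact measureReal_closedBall_zero μ k

lemma measureReal_sphere_zero (k : ℕ) :
    μ.real (Metric.sphere 0 ((p : ℝ)⁻¹ ^ k)) = (p : ℝ)⁻¹ ^ k * (1 - (p : ℝ)⁻¹) := by
  have hp : (1 : ℝ) < p := by exact_mod_cast (Fact.out : p.Prime).one_lt
  have hsphere : Metric.sphere (0 : ℤ_[p]) ((p : ℝ)⁻¹ ^ k) =
      Metric.closedBall 0 ((p : ℝ)⁻¹ ^ k) \ Metric.closedBall 0 ((p : ℝ)⁻¹ ^ (k + 1)) := by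
    ext x
    have h := PadicInt.norm_le_pow_iff_norm_lt_pow_add_one x (-((k + 1 : ℕ) : ℤ))
    rw [show -((k + 1 : ℕ) : ℤ) + 1 = -(k : ℤ) by push_cast; ring, zpow_neg, zpow_neg,
      zpow_natCast, zpow_natCast, ← inv_pow, ← inv_pow] at h
    simp only [mem_sphere_iff_norm, sub_zero, Set.mem_sdiff, mem_closedBall_zero_iff, h, not_lt]
    exact le_antisymm_iff
  rw [hsphere, measureReal_sdiff (Metric.closedBall_subset_closedBall
    (pow_le_pow_of_le_one (by positivity) (inv_le_one_of_one_le₀ hp.le) (Nat.le_add_right k 1)))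
    Metric.isClosed_closedBall.measurableSet, measureReal_closedBall_zero,
    measureReal_closedBall_zero]
  ring

end HaarMeasure

section DiscFun

variable {p : ℕ} [Fact p.Prime] (N : ℕ) (α : ℕ → ℤ_[p])

lemma discFun_eq_of_mem {a x y : ℤ_[p]} {r : ℝ} (hx : x ∈ Metric.closedBall a r) (hy : ‖y‖ = r) :
    discFun p N α x y = (#{n ∈ Finset.Icc 1 N | ‖α n - a‖ ≤ r} : ℝ) / N - r := by
  have hball : Metric.closedBall x r = Metric.closedBall a r :=
    (IsUltrametricDist.closedBall_eq_of_mem hx).symm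
  have hiff (z : ℤ_[p]) : ‖z - x‖ ≤ r ↔ ‖z - a‖ ≤ r := by
    simpa [dist_eq_norm] using Set.ext_iff.1 hball z
  simp only [discFun, hy, hiff]

lemma card_filter_div_mem_Icc (P : ℕ → Prop) :
    (#{n ∈ Finset.Icc 1 N | P n} : ℝ) / N ∈ Set.Icc (0 : ℝ) 1 := by
  refine ⟨by positivity, div_le_one_of_le₀ ?_ (Nat.cast_nonneg N)⟩
  exact_mod_cast (card_filter_le _ _).trans (by simp)

lemma abs_discFun_le_one (x y : ℤ_[p]) : |discFun p N α x y| ≤ 1 := by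
  have h := card_filter_div_mem_Icc N fun n => ‖α n - x‖ ≤ ‖y‖
  rw [discFun, abs_le]
  constructor <;> linarith [h.1, h.2, norm_nonneg y, PadicInt.norm_le_one y]

lemma measurable_uncurry_discFun : Measurable (Function.uncurry (discFun p N α)) := by
  have hset (n : ℕ) : MeasurableSet {z : ℤ_[p] × ℤ_[p] | ‖α n - z.1‖ ≤ ‖z.2‖} :=
    measurableSet_le
      ((continuous_const.sub continuous_id).norm.measurable.comp measurable_fst)
      (continuous_norm.measurable.comp measurable_snd)
  simp only [Function.uncurry_def, discFun, card_filter, Nat.cast_sum, Nat.cast_ite,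
    Nat.cast_one, Nat.cast_zero]
  exact ((Finset.measurable_sum _ fun n _ =>
    Measurable.ite (hset n) measurable_const measurable_const).div_const _).sub
      (continuous_norm.measurable.comp measurable_snd)

variable (μ : Measure ℤ_[p]) [μ.IsAddHaarMeasure] [IsProbabilityMeasure μ]

lemma sq_mul_sq_le_integral_discFun (a : ℤ_[p]) (j : ℕ) :
    (1 - (p : ℝ)⁻¹) * ((p : ℝ)⁻¹ ^ j *
        |(#{n ∈ Finset.Icc 1 N | ‖α n - a‖ ≤ (p : ℝ)⁻¹ ^ j} : ℝ) / N - (p : ℝ)⁻¹ ^ j|) ^ 2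
      ≤ ∫ x, ∫ y, |discFun p N α x y| ^ 2 ∂μ ∂μ := by
  set r : ℝ := (p : ℝ)⁻¹ ^ j
  set δ : ℝ := |(#{n ∈ Finset.Icc 1 N | ‖α n - a‖ ≤ r} : ℝ) / N - r|
  have hmeas : Measurable (Function.uncurry fun x y => |discFun p N α x y| ^ 2) :=
    (measurable_uncurry_discFun N α).norm.pow_const 2
  have hbound (x y : ℤ_[p]) : ‖|discFun p N α x y| ^ 2‖ ≤ 1 := by
    rw [Real.norm_of_nonneg (by positivity)]
    exact pow_le_one₀ (abs_nonneg _) (abs_discFun_le_one N α x y)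
  have hfint (x : ℤ_[p]) : Integrable (fun y => |discFun p N α x y| ^ 2) μ :=
    .of_bound (hmeas.comp measurable_prodMk_left).aestronglyMeasurable 1 (.of_forall (hbound x))
  have hfint' : Integrable (fun x => ∫ y, |discFun p N α x y| ^ 2 ∂μ) μ :=
    .of_bound hmeas.stronglyMeasurable.integral_prod_right.aestronglyMeasurable 1
      (.of_forall fun x => by
        simpa using norm_integral_le_of_norm_le_const (μ := μ) (.of_forall (hbound x)))
  have hinner (x : ℤ_[p]) (hx : x ∈ Metric.closedBall a r) :
      r * (1 - (p : ℝ)⁻¹) * δ ^ 2 ≤ ∫ y, |discFun p N α x y| ^ 2 ∂μ :=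
    calc r * (1 - (p : ℝ)⁻¹) * δ ^ 2 = ∫ _ in Metric.sphere (0 : ℤ_[p]) r, δ ^ 2 ∂μ := by
          rw [setIntegral_const, measureReal_sphere_zero, smul_eq_mul]
      _ = ∫ y in Metric.sphere 0 r, |discFun p N α x y| ^ 2 ∂μ :=
          setIntegral_congr_fun Metric.isClosed_sphere.measurableSet fun y hy => by
            simp only [discFun_eq_of_mem N α hx (mem_sphere_zero_iff_norm.1 hy), δ]
      _ ≤ ∫ y, |discFun p N α x y| ^ 2 ∂μ :=
          setIntegral_le_integral (hfint x) (.of_forall fun y => by positivity)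
  calc (1 - (p : ℝ)⁻¹) * (r * δ) ^ 2
      = ∫ _ in Metric.closedBall a r, r * (1 - (p : ℝ)⁻¹) * δ ^ 2 ∂μ := by
        rw [setIntegral_const, measureReal_closedBall, smul_eq_mul]
        ring
    _ ≤ ∫ x in Metric.closedBall a r, ∫ y, |discFun p N α x y| ^ 2 ∂μ ∂μ :=
        setIntegral_mono_on integrableOn_const hfint'.integrableOn
          Metric.isClosed_closedBall.measurableSet hinner
    _ ≤ ∫ x, ∫ y, |discFun p N α x y| ^ 2 ∂μ ∂μ :=
        setIntegral_le_integral hfint' (.of_forall fun x => integral_nonneg fun y => by positivity)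

lemma pow_four_le_integral_discFun (a : ℤ_[p]) (k : ℕ) :
    |(#{n ∈ Finset.Icc 1 N | ‖α n - a‖ ≤ (p : ℝ)⁻¹ ^ k} : ℝ) / N - (p : ℝ)⁻¹ ^ k| ^ 4
      ≤ (p : ℝ) ^ 9 / ((p : ℝ) - 1) ^ 3 * ∫ x, ∫ y, |discFun p N α x y| ^ 2 ∂μ ∂μ := by
  have hp2 : (2 : ℝ) ≤ p := by exact_mod_cast (Fact.out : p.Prime).two_le
  have hp1 : (0 : ℝ) < p - 1 := by linarith
  let c (j : ℕ) : ℝ := (#{n ∈ Finset.Icc 1 N | ‖α n - a‖ ≤ (p : ℝ)⁻¹ ^ j} : ℝ) / N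
  have hanti : Antitone c := fun i j hij => by
    have hle : (p : ℝ)⁻¹ ^ j ≤ (p : ℝ)⁻¹ ^ i :=
      pow_le_pow_of_le_one (by positivity) (inv_le_one_of_one_le₀ (by linarith)) hij
    simp only [c]
    gcongr
  obtain ⟨j, hj⟩ := exists_sq_abs_sub_pow_le (by positivity) (inv_lt_one_of_one_lt₀ (by linarith))
    hanti (fun j => (card_filter_div_mem_Icc N _).1) (fun j => (card_filter_div_mem_Icc N _).2) k
  have hI := sq_mul_sq_le_integral_discFun N α μ a j
  change |c k - (p : ℝ)⁻¹ ^ k| ^ 4 ≤ _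
  change (1 - (p : ℝ)⁻¹) * ((p : ℝ)⁻¹ ^ j * |c j - (p : ℝ)⁻¹ ^ j|) ^ 2 ≤ _ at hI
  set I := ∫ x, ∫ y, |discFun p N α x y| ^ 2 ∂μ ∂μ
  set d := |c k - (p : ℝ)⁻¹ ^ k|
  set e := (p : ℝ)⁻¹ ^ j * |c j - (p : ℝ)⁻¹ ^ j|
  have hd : d ^ 2 ≤ 4 * p * e := by
    rw [inv_mul_le_iff₀ (by linarith)] at hj
    linarith
  have hconst : 16 * (p : ℝ) ^ 2 ≤ (p : ℝ) ^ 9 / ((p : ℝ) - 1) ^ 3 * (1 - (p : ℝ)⁻¹) := by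
    have hcube : 4 * ((p : ℝ) - 1) ≤ p ^ 3 := by
      nlinarith [mul_nonneg (sub_nonneg.2 hp2) (sq_nonneg (p : ℝ)), sq_nonneg ((p : ℝ) - 2)]
    have hsq : (4 * ((p : ℝ) - 1)) ^ 2 ≤ (p ^ 3) ^ 2 := by gcongr
    have heq : (p : ℝ) ^ 9 / ((p : ℝ) - 1) ^ 3 * (1 - (p : ℝ)⁻¹) =
        p ^ 2 * (p ^ 3) ^ 2 / (p - 1) ^ 2 := by field_simp
    rw [heq, le_div_iff₀ (by positivity)]
    nlinarith [mul_le_mul_of_nonneg_left hsq (sq_nonneg (p : ℝ))]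
  calc d ^ 4 = (d ^ 2) ^ 2 := by ring
    _ ≤ (4 * p * e) ^ 2 := by gcongr
    _ = 16 * (p : ℝ) ^ 2 * e ^ 2 := by ring
    _ ≤ (p : ℝ) ^ 9 / ((p : ℝ) - 1) ^ 3 * (1 - (p : ℝ)⁻¹) * e ^ 2 := by gcongr
    _ = (p : ℝ) ^ 9 / ((p : ℝ) - 1) ^ 3 * ((1 - (p : ℝ)⁻¹) * e ^ 2) := by ring
    _ ≤ (p : ℝ) ^ 9 / ((p : ℝ) - 1) ^ 3 * I := by gcongr

end DiscFun

/-- Lower-bound lemma: `D_N⁴ ≤ C₁(p) ‖f‖₂²` with `C₁(p) = p⁹/(p-1)³`, where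
`f(x,y) = #{n ≤ N : αₙ ∈ D(x,|y|_p)}/N - |y|_p` and `μ` is the normalized Haar measure. -/
theorem discrepancy_le_l2_norm (p : ℕ) [Fact p.Prime] (μ : Measure ℤ_[p])
    [μ.IsAddHaarMeasure] [IsProbabilityMeasure μ]
    (N : ℕ) (hN : 1 ≤ N) (α : ℕ → ℤ_[p]) :
    disc p N α ^ 4
      ≤ ((p : ℝ) ^ 9 / ((p : ℝ) - 1) ^ 3) * ∫ x, ∫ y, |discFun p N α x y| ^ 2 ∂μ ∂μ := by
  set B := (p : ℝ) ^ 9 / ((p : ℝ) - 1) ^ 3 * ∫ x, ∫ y, |discFun p N α x y| ^ 2 ∂μ ∂μ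
  have hB0 : 0 ≤ B := le_trans (by positivity) (pow_four_le_integral_discFun N α μ 0 0)
  have hroot : (B ^ (1 / 4 : ℝ)) ^ 4 = B := by
    rw [← Real.rpow_natCast, ← Real.rpow_mul hB0]
    norm_num
  have hroot0 : 0 ≤ B ^ (1 / 4 : ℝ) := by positivity
  have hdisc0 : 0 ≤ disc p N α := Real.iSup_nonneg fun a => Real.iSup_nonneg fun k => abs_nonneg _
  have hdisc : disc p N α ≤ B ^ (1 / 4 : ℝ) := by
    refine Real.iSup_le (fun a => Real.iSup_le (fun k => ?_) hroot0) hroot0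
    refine le_of_pow_le_pow_left₀ four_ne_zero hroot0 ?_
    rw [hroot, zpow_neg, zpow_natCast, ← inv_pow]
    exact pow_four_le_integral_discFun N α μ a k
  calc disc p N α ^ 4 ≤ (B ^ (1 / 4 : ℝ)) ^ 4 := by gcongr
    _ = B := hroot
end
end

section
/- Let p be a prime, R = p^{−k} with k ≥ 1, and let ω ∈ ℤ(p^∞) be a p-power root of unity whose order satisfies ‖ω‖ ≤ 1/R = p^k. Then ∫_{{y ∈ ℤ_p : |y|_p ≤ R}} |y|_p · ω^{−y} dμ(y) = p·R² / (p+1). -/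
open MeasureTheory Filter Finset
open scoped Classical

noncomputable section

/-- In `ℤ_p`, the closed ball of radius `p^{-k}` has mass `p^{-k}` for the normalized Haar
measure. -/
lemma measureReal_padicInt_closedBall (p : ℕ) [Fact p.Prime] (μ : Measure ℤ_[p])
    [μ.IsAddHaarMeasure] [IsProbabilityMeasure μ] (k : ℕ) :
    μ.real {y : ℤ_[p] | ‖y‖ ≤ (p : ℝ) ^ (-(k : ℤ))} = (p : ℝ) ^ (-(k : ℤ)) := by
  have hp : 0 < p := (Fact.out : p.Prime).pos
  have : NeZero (p ^ k) := ⟨by positivity⟩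
  set f := (PadicInt.toZModPow (p := p) k).toAddMonoidHom with hf
  have hker : (f.ker : Set ℤ_[p]) = {y : ℤ_[p] | ‖y‖ ≤ (p : ℝ) ^ (-(k : ℤ))} := by
    ext y
    rw [Set.mem_ofPred_eq, PadicInt.norm_le_pow_iff_mem_span_pow, ← PadicInt.ker_toZModPow]
    rfl
  have hsurj : Function.Surjective f := ZMod.ringHom_surjective (PadicInt.toZModPow k)
  have hindex : f.ker.index = p ^ k := by
    rw [AddSubgroup.index_ker, AddMonoidHom.range_eq_top.mpr hsurj, AddSubgroup.card_top,
      Nat.card_zmod]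
  have : f.ker.FiniteIndex := ⟨by rw [hindex]; positivity⟩
  have hmeas : MeasurableSet (f.ker : Set ℤ_[p]) := by
    rw [hker]
    exact (isClosed_le continuous_norm continuous_const).measurableSet
  have h := congrArg ENNReal.toReal (AddSubgroup.index_mul_measure f.ker hmeas μ)
  rw [hindex, hker, measure_univ, ENNReal.toReal_mul] at h
  rw [ENNReal.toReal_natCast, Nat.cast_pow, ENNReal.toReal_one, ← zpow_natCast] at h
  rw [zpow_neg] at h ⊢
  exact eq_inv_of_mul_eq_one_right h

lemma integrable_norm_padicInt (p : ℕ) [Fact p.Prime] (μ : Measure ℤ_[p])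
    [IsFiniteMeasure μ] : Integrable (fun y : ℤ_[p] => ‖y‖) μ :=
  Integrable.of_bound continuous_norm.aestronglyMeasurable 1
    (.of_forall fun y => by simpa using PadicInt.norm_le_one y)

lemma setIntegral_norm_closedBall_eq_add (p : ℕ) [Fact p.Prime] (μ : Measure ℤ_[p])
    [μ.IsAddHaarMeasure] [IsProbabilityMeasure μ] (k : ℕ) :
    ∫ y in {y : ℤ_[p] | ‖y‖ ≤ (p : ℝ) ^ (-(k : ℤ))}, ‖y‖ ∂μ
      = ∫ y in {y : ℤ_[p] | ‖y‖ ≤ (p : ℝ) ^ (-((k + 1 : ℕ) : ℤ))}, ‖y‖ ∂μ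
        + ((p : ℝ) ^ (-(k : ℤ)) - (p : ℝ) ^ (-((k + 1 : ℕ) : ℤ))) * (p : ℝ) ^ (-(k : ℤ)) := by
  have hp : 1 < (p : ℝ) := mod_cast (Fact.out : p.Prime).one_lt
  have hmeas (n : ℕ) : MeasurableSet {y : ℤ_[p] | ‖y‖ ≤ (p : ℝ) ^ (-(n : ℤ))} :=
    (isClosed_le continuous_norm continuous_const).measurableSet
  have hsub : {y : ℤ_[p] | ‖y‖ ≤ (p : ℝ) ^ (-((k + 1 : ℕ) : ℤ))} ⊆
      {y : ℤ_[p] | ‖y‖ ≤ (p : ℝ) ^ (-(k : ℤ))} := fun y hy =>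
    le_trans hy (zpow_le_zpow_right₀ hp.le (by push_cast; lia))
  have hsphere : ∫ y in {y : ℤ_[p] | ‖y‖ ≤ (p : ℝ) ^ (-(k : ℤ))} \
      {y : ℤ_[p] | ‖y‖ ≤ (p : ℝ) ^ (-((k + 1 : ℕ) : ℤ))}, ‖y‖ ∂μ
      = ∫ _ in {y : ℤ_[p] | ‖y‖ ≤ (p : ℝ) ^ (-(k : ℤ))} \
      {y : ℤ_[p] | ‖y‖ ≤ (p : ℝ) ^ (-((k + 1 : ℕ) : ℤ))}, (p : ℝ) ^ (-(k : ℤ)) ∂μ := by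
    refine setIntegral_congr_fun ((hmeas k).diff (hmeas (k + 1))) fun y hy => ?_
    refine le_antisymm hy.1 (not_lt.mp fun h => hy.2 ?_)
    rw [PadicInt.norm_lt_pow_iff_norm_le_pow_sub_one] at h
    rw [Set.mem_ofPred_eq]
    convert h using 2
    push_cast
    ring
  rw [setIntegral_const, measureReal_sdiff hsub (hmeas (k + 1)),
    measureReal_padicInt_closedBall, measureReal_padicInt_closedBall, smul_eq_mul] at hsphere
  rw [← hsphere, add_comm, ← setIntegral_union Set.disjoint_sdiff_left (hmeas (k + 1))
    (integrable_norm_padicInt p μ).integrableOn (integrable_norm_padicInt p μ).integrableOn,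
    Set.sdiff_union_of_subset hsub]

lemma setIntegral_norm_closedBall (p : ℕ) [Fact p.Prime] (μ : Measure ℤ_[p])
    [μ.IsAddHaarMeasure] [IsProbabilityMeasure μ] (k : ℕ) :
    ∫ y in {y : ℤ_[p] | ‖y‖ ≤ (p : ℝ) ^ (-(k : ℤ))}, ‖y‖ ∂μ
      = (p : ℝ) * ((p : ℝ) ^ (-(k : ℤ))) ^ 2 / ((p : ℝ) + 1) := by
  have hp : 1 < (p : ℝ) := mod_cast (Fact.out : p.Prime).one_lt
  have hp0 : 0 < (p : ℝ) := by positivity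
  set F : ℕ → ℝ := fun n => ∫ y in {y : ℤ_[p] | ‖y‖ ≤ (p : ℝ) ^ (-(n : ℤ))}, ‖y‖ ∂μ with hF
  set G : ℕ → ℝ := fun n => (p : ℝ) * ((p : ℝ) ^ (-(n : ℤ))) ^ 2 / ((p : ℝ) + 1) with hG
  have hstep (n : ℕ) : F (n + 1) - G (n + 1) = F n - G n := by
    have h : F n = F (n + 1) + _ := setIntegral_norm_closedBall_eq_add p μ n
    rw [h]
    simp only [hG, zpow_neg, zpow_natCast, pow_succ]
    field_simp
    ring
  have hconst (n : ℕ) : F (n + k) - G (n + k) = F k - G k := by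
    induction n with
    | zero => simp
    | succ n ih => rw [← ih, ← hstep (n + k), Nat.succ_add_eq_add_succ, add_assoc]
  have hball : Tendsto (fun n : ℕ => ((p : ℝ) ^ (-(n : ℤ))) ^ 2) atTop (nhds 0) := by
    have h := (tendsto_pow_atTop_nhds_zero_of_lt_one (inv_nonneg.mpr hp0.le)
      (inv_lt_one_of_one_lt₀ hp)).pow 2
    simpa [zpow_neg] using h
  have hFlim : Tendsto F atTop (nhds 0) := by
    refine squeeze_zero_norm (fun n => ?_) hball
    calc ‖F n‖ ≤ (p : ℝ) ^ (-(n : ℤ)) * μ.real {y : ℤ_[p] | ‖y‖ ≤ (p : ℝ) ^ (-(n : ℤ))} :=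
          norm_setIntegral_le_of_norm_le_const (measure_lt_top _ _) fun y hy => by simpa using hy
      _ = ((p : ℝ) ^ (-(n : ℤ))) ^ 2 := by rw [measureReal_padicInt_closedBall, sq]
  have hGlim : Tendsto G atTop (nhds 0) := by
    simpa [hG] using (hball.const_mul (p : ℝ)).div_const ((p : ℝ) + 1)
  have hlim := (tendsto_add_atTop_iff_nat k).mpr (hFlim.sub hGlim)
  simp only [hconst, sub_zero] at hlim
  exact sub_eq_zero.mp (tendsto_nhds_unique tendsto_const_nhds hlim)

lemma pruferChar_eq_one (p : ℕ) [Fact p.Prime] (k : ℕ) (ω : ℂ) (hω : ω ∈ prufer p)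
    (hord : orderOf ω ≤ p ^ k) (x : ℤ_[p]) (hx : ‖x‖ ≤ (p : ℝ) ^ (-(k : ℤ))) :
    pruferChar p ω x = 1 := by
  have hp : p.Prime := Fact.out
  obtain ⟨m, hm⟩ := hω
  obtain ⟨n, -, hn⟩ := (Nat.dvd_prime_pow hp).mp (orderOf_dvd_of_pow_eq_one hm)
  have hnk : n ≤ k := (Nat.pow_le_pow_iff_right hp.one_lt).mp (hn ▸ hord)
  have hnord : n ≤ orderOf ω := hn ▸ (Nat.lt_pow_self hp.one_lt).le
  have hdvd_x : (p : ℤ_[p]) ^ n ∣ x := by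
    rw [PadicInt.norm_le_pow_iff_mem_span_pow, Ideal.mem_span_singleton] at hx
    exact (pow_dvd_pow _ hnk).trans hx
  have hdvd_sub : (p : ℤ_[p]) ^ n ∣ x - x.appr (orderOf ω) :=
    (pow_dvd_pow _ hnord).trans (Ideal.mem_span_singleton.mp (PadicInt.appr_spec _ x))
  have hdvd : (p : ℤ_[p]) ^ n ∣ ((x.appr (orderOf ω) : ℤ) : ℤ_[p]) := by
    simpa using dvd_sub hdvd_x hdvd_sub
  rw [PadicInt.pow_p_dvd_int_iff] at hdvd
  rw [← Nat.cast_pow, Int.natCast_dvd_natCast] at hdvd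
  exact orderOf_dvd_iff_pow_eq_one.mp (hn.dvd.trans hdvd)

/-- For `R = p^{-k}` (`k ≥ 1`) and `ω ∈ ℤ(p^∞)` with `‖ω‖ ≤ p^k = 1/R`:
`∫_{|y| ≤ R} |y| ω^{-y} dμ(y) = p R² / (p + 1)`. -/
theorem integral_small_order (p : ℕ) [Fact p.Prime] (μ : Measure ℤ_[p])
    [μ.IsAddHaarMeasure] [IsProbabilityMeasure μ]
    (k : ℕ) (hk : 1 ≤ k) (ω : ℂ) (hω : ω ∈ prufer p) (hord : orderOf ω ≤ p ^ k) :
    ∫ y in {y : ℤ_[p] | ‖y‖ ≤ (p : ℝ) ^ (-(k : ℤ))},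
        (‖y‖ : ℂ) * pruferChar p ω (-y) ∂μ
      = (((p : ℝ) * ((p : ℝ) ^ (-(k : ℤ))) ^ 2 / ((p : ℝ) + 1) : ℝ) : ℂ) := by
  have hmeas : MeasurableSet {y : ℤ_[p] | ‖y‖ ≤ (p : ℝ) ^ (-(k : ℤ))} :=
    (isClosed_le continuous_norm continuous_const).measurableSet
  rw [← setIntegral_norm_closedBall p μ k, ← integral_complex_ofReal]
  refine setIntegral_congr_fun hmeas fun y hy => ?_
  simp only [pruferChar_eq_one p k ω hω hord (-y) (by simpa using hy), mul_one]
end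
end

section
/- Let p be a prime, R = p^{−k} with k ≥ 1, and let ω ∈ ℤ(p^∞) be a p-power root of unity whose order satisfies ‖ω‖ > 1/R = p^k. Then ∫_{{y ∈ ℤ_p : |y|_p ≤ R}} |y|_p · ω^{−y} dμ(y) = −p² / ((p+1)·‖ω‖²). -/
open MeasureTheory Filter Finset
open scoped Classical

noncomputable section

namespace PadicInt

variable {p : ℕ} [Fact p.Prime]

/-- The closed ball of radius `p⁻ʲ` around `0` in `ℤ_p`. -/
def zeroBall (p : ℕ) [Fact p.Prime] (j : ℕ) : Set ℤ_[p] := {y | ‖y‖ ≤ (p : ℝ) ^ (-(j : ℤ))}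

theorem mem_zeroBall_iff {j : ℕ} {x : ℤ_[p]} :
    x ∈ zeroBall p j ↔ x ∈ (Ideal.span {(p : ℤ_[p]) ^ j} : Ideal ℤ_[p]) :=
  norm_le_pow_iff_mem_span_pow x j

theorem measurableSet_zeroBall (j : ℕ) : MeasurableSet (zeroBall p j) :=
  (isClosed_le continuous_norm continuous_const).measurableSet

theorem zeroBall_succ_subset (j : ℕ) : zeroBall p (j + 1) ⊆ zeroBall p j := fun x hx => by
  rw [mem_zeroBall_iff, Ideal.mem_span_singleton] at hx ⊢
  exact (pow_dvd_pow _ j.le_succ).trans hx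

theorem norm_eq_of_mem_zeroBall_diff {j : ℕ} {x : ℤ_[p]}
    (hx : x ∈ zeroBall p j \ zeroBall p (j + 1)) : ‖x‖ = (p : ℝ) ^ (-(j : ℤ)) := by
  refine le_antisymm hx.1 (not_lt.mp fun h => hx.2 ?_)
  rw [norm_lt_pow_iff_norm_le_pow_sub_one] at h
  simpa [zeroBall, sub_eq_add_neg, add_comm] using h

theorem measureReal_zeroBall (μ : Measure ℤ_[p]) [μ.IsAddHaarMeasure] [IsProbabilityMeasure μ]
    (j : ℕ) : μ.real (zeroBall p j) = ((p : ℝ) ^ j)⁻¹ := by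
  have hp : (p : ℝ) ^ j ≠ 0 := pow_ne_zero _ (by exact_mod_cast (Fact.out : p.Prime).ne_zero)
  let H : AddSubgroup ℤ_[p] := (toZModPow j : ℤ_[p] →+* ZMod (p ^ j)).toAddMonoidHom.ker
  have hH : (H : Set ℤ_[p]) = zeroBall p j := by
    ext x
    rw [mem_zeroBall_iff, ← ker_toZModPow]
    rfl
  have hindex : H.index = p ^ j := by
    rw [AddSubgroup.index_ker, AddMonoidHom.range_eq_top.mpr]
    · simp
    · exact ZMod.ringHom_surjective (toZModPow j : ℤ_[p] →+* ZMod (p ^ j))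
  have : H.FiniteIndex := ⟨by
    rw [hindex]; exact pow_ne_zero _ (Fact.out : p.Prime).ne_zero⟩
  have h := AddSubgroup.index_mul_measure H (hH ▸ measurableSet_zeroBall j) μ
  rw [hH, hindex, measure_univ] at h
  have h' := congrArg ENNReal.toReal h
  rw [ENNReal.toReal_mul] at h'
  simp only [ENNReal.toReal_one, Nat.cast_pow] at h'
  rw [Measure.real]
  exact eq_inv_of_mul_eq_one_right h'

end PadicInt

open PadicInt

section PruferChar

variable {p : ℕ} [Fact p.Prime] {ω : ℂ} {m : ℕ}

theorem exists_orderOf_eq_of_mem_prufer (hω : ω ∈ prufer p) : ∃ m, orderOf ω = p ^ m := by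
  obtain ⟨n, hn⟩ := hω
  obtain ⟨m, -, hm⟩ := (Nat.dvd_prime_pow Fact.out).mp (orderOf_dvd_of_pow_eq_one hn)
  exact ⟨m, hm⟩

theorem pruferChar_eq_pow (hm : orderOf ω = p ^ m) {x : ℤ_[p]} {a : ℕ}
    (ha : x - a ∈ (Ideal.span {(p : ℤ_[p]) ^ m} : Ideal ℤ_[p])) :
    pruferChar p ω x = ω ^ a := by
  have hmn : m ≤ orderOf ω := by
    rw [hm]
    exact (Nat.lt_pow_self (Fact.out : p.Prime).one_lt).le
  have hx : x - (x.appr (orderOf ω) : ℕ) ∈ (Ideal.span {(p : ℤ_[p]) ^ m} : Ideal ℤ_[p]) :=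
    Ideal.span_singleton_le_span_singleton.mpr (pow_dvd_pow _ hmn) (appr_spec _ x)
  have h := zmod_congr_of_sub_mem_span m x _ a hx ha
  rw [ZMod.natCast_eq_natCast_iff, ← hm] at h
  rw [pruferChar, ← pow_mod_orderOf, h, pow_mod_orderOf]

theorem pruferChar_add (hm : orderOf ω = p ^ m) (x y : ℤ_[p]) :
    pruferChar p ω (x + y) = pruferChar p ω x * pruferChar p ω y := by
  rw [pruferChar_eq_pow hm (appr_spec m x), pruferChar_eq_pow hm (appr_spec m y), ← pow_add]
  refine pruferChar_eq_pow hm ?_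
  have := add_mem (appr_spec m x) (appr_spec m y)
  convert! this using 1
  push_cast
  ring

theorem pruferChar_natCast (hm : orderOf ω = p ^ m) (a : ℕ) : pruferChar p ω a = ω ^ a :=
  pruferChar_eq_pow hm (by simp)

theorem pruferChar_of_mem_zeroBall (hm : orderOf ω = p ^ m) {x : ℤ_[p]}
    (hx : x ∈ zeroBall p m) : pruferChar p ω x = 1 := by
  rw [mem_zeroBall_iff] at hx
  simpa using pruferChar_eq_pow hm (a := 0) (by simpa using hx)

theorem continuous_pruferChar (hm : orderOf ω = p ^ m) : Continuous (pruferChar p ω) := by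
  refine IsLocallyConstant.continuous ((IsLocallyConstant.iff_eventually_eq _).mpr fun x => ?_)
  have hp : (0 : ℝ) < (p : ℝ) ^ (-(m : ℤ)) :=
    zpow_pos (by exact_mod_cast (Fact.out : p.Prime).pos) _
  filter_upwards [Metric.closedBall_mem_nhds x hp] with y hy
  rw [Metric.mem_closedBall, dist_eq_norm] at hy
  rw [← sub_add_cancel y x, pruferChar_add hm, pruferChar_of_mem_zeroBall hm hy, one_mul]

theorem norm_pruferChar (hm : orderOf ω = p ^ m) (x : ℤ_[p]) : ‖pruferChar p ω x‖ = 1 := by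
  have hω : ‖ω‖ = 1 := Complex.norm_eq_one_of_pow_eq_one (pow_orderOf_eq_one ω) (by
    rw [hm]
    exact pow_ne_zero _ (Fact.out : p.Prime).ne_zero)
  simp [pruferChar, hω]

end PruferChar

section Integral

variable {p : ℕ} [Fact p.Prime] {ω : ℂ} {m : ℕ}
  (μ : Measure ℤ_[p]) [μ.IsAddHaarMeasure]

theorem setIntegral_pruferChar_neg_of_lt (hm : orderOf ω = p ^ m) {j : ℕ} (hj : j < m) :
    ∫ y in zeroBall p j, pruferChar p ω (-y) ∂μ = 0 := by
  have hne : ω ^ p ^ j ≠ 1 := by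
    refine pow_ne_one_of_lt_orderOf (pow_ne_zero _ (Fact.out : p.Prime).ne_zero) ?_
    rw [hm]
    exact Nat.pow_lt_pow_right (Fact.out : p.Prime).one_lt hj
  set c : ℤ_[p] := ((p ^ j : ℕ) : ℤ_[p]) with hc
  have hcmem : c ∈ (Ideal.span {(p : ℤ_[p]) ^ j} : Ideal ℤ_[p]) := by
    simp [hc]
  set f := (zeroBall p j).indicator fun y => pruferChar p ω (-y)
  have hf (y : ℤ_[p]) : f (-c + y) = ω ^ p ^ j * f y := by
    have hiff : -c + y ∈ zeroBall p j ↔ y ∈ zeroBall p j := by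
      simp only [mem_zeroBall_iff]
      exact Ideal.add_mem_iff_right _ (neg_mem hcmem)
    by_cases hy : y ∈ zeroBall p j
    · simp only [f, Set.indicator_of_mem hy, Set.indicator_of_mem (hiff.mpr hy)]
      rw [neg_add, neg_neg, pruferChar_add hm, hc, pruferChar_natCast hm]
    · simp only [f, Set.indicator_of_notMem hy, Set.indicator_of_notMem (mt hiff.mp hy), mul_zero]
  rw [← integral_indicator (measurableSet_zeroBall j)]
  have h := integral_add_left_eq_self (μ := μ) f (-c)
  simp_rw [hf] at h
  rw [integral_const_mul] at h
  by_contra h0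
  exact hne (mul_right_cancel₀ h0 (by rw [h, one_mul]))

theorem setIntegral_norm_mul_pruferChar_neg_succ (hm : orderOf ω = p ^ m) (j : ℕ) :
    ∫ y in zeroBall p j, (‖y‖ : ℂ) * pruferChar p ω (-y) ∂μ =
      (∫ y in zeroBall p (j + 1), (‖y‖ : ℂ) * pruferChar p ω (-y) ∂μ) +
        ((p : ℂ) ^ j)⁻¹ * ((∫ y in zeroBall p j, pruferChar p ω (-y) ∂μ) -
          ∫ y in zeroBall p (j + 1), pruferChar p ω (-y) ∂μ) := by
  have hχ : Continuous fun y : ℤ_[p] => pruferChar p ω (-y) :=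
    (continuous_pruferChar hm).comp continuous_neg
  have hint {f : ℤ_[p] → ℂ} (hf : Continuous f) : Integrable f μ :=
    hf.integrable_of_hasCompactSupport (HasCompactSupport.of_compactSpace f)
  have hmul : Continuous fun y : ℤ_[p] => (‖y‖ : ℂ) * pruferChar p ω (-y) :=
    (Complex.continuous_ofReal.comp continuous_norm).mul hχ
  rw [← setIntegral_sdiff (measurableSet_zeroBall _) (hint hχ).integrableOn (zeroBall_succ_subset j),
    ← sub_eq_iff_eq_add', ← setIntegral_sdiff (measurableSet_zeroBall _) (hint hmul).integrableOn
      (zeroBall_succ_subset j), ← integral_const_mul]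
  refine setIntegral_congr_fun
    ((measurableSet_zeroBall j).diff (measurableSet_zeroBall (j + 1))) fun y hy => ?_
  simp [norm_eq_of_mem_zeroBall_diff hy]

variable [IsProbabilityMeasure μ]

theorem setIntegral_pruferChar_neg_of_le (hm : orderOf ω = p ^ m) {j : ℕ} (hj : m ≤ j) :
    ∫ y in zeroBall p j, pruferChar p ω (-y) ∂μ = ((p : ℂ) ^ j)⁻¹ := by
  have h : ∀ y ∈ zeroBall p j, pruferChar p ω (-y) = 1 := fun y hy => by
    refine pruferChar_of_mem_zeroBall hm ?_
    rw [mem_zeroBall_iff] at hy ⊢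
    exact neg_mem (Ideal.span_singleton_le_span_singleton.mpr (pow_dvd_pow _ hj) hy)
  rw [setIntegral_congr_fun (measurableSet_zeroBall j) h]
  simp [measureReal_zeroBall]

theorem tendsto_setIntegral_norm_mul_pruferChar_neg (hm : orderOf ω = p ^ m) :
    Tendsto (fun j => ∫ y in zeroBall p j, (‖y‖ : ℂ) * pruferChar p ω (-y) ∂μ)
      atTop (nhds 0) := by
  have hp : (1 : ℝ) < p := by exact_mod_cast (Fact.out : p.Prime).one_lt
  have hlim : Tendsto (fun j : ℕ => ((p : ℝ) ^ j)⁻¹) atTop (nhds 0) :=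
    tendsto_inv_atTop_zero.comp (tendsto_pow_atTop_atTop_of_one_lt hp)
  refine squeeze_zero_norm (fun j => ?_) hlim
  refine (norm_setIntegral_le_of_norm_le_const (C := 1) (measure_lt_top _ _) fun y _ => ?_).trans ?_
  · simpa [norm_pruferChar hm] using y.norm_le_one
  · rw [one_mul, measureReal_zeroBall]

theorem setIntegral_norm_mul_pruferChar_neg_of_le (hm : orderOf ω = p ^ m) {j : ℕ} (hj : m ≤ j) :
    ∫ y in zeroBall p j, (‖y‖ : ℂ) * pruferChar p ω (-y) ∂μ =
      (p : ℂ) / (((p : ℂ) + 1) * ((p : ℂ) ^ j) ^ 2) := by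
  have hp : (1 : ℝ) < p := by exact_mod_cast (Fact.out : p.Prime).one_lt
  have hp0 : (p : ℂ) ≠ 0 := by exact_mod_cast (Fact.out : p.Prime).ne_zero
  have hp1 : (p : ℂ) + 1 ≠ 0 := by exact_mod_cast p.succ_ne_zero
  set I : ℕ → ℂ := fun i => ∫ y in zeroBall p i, (‖y‖ : ℂ) * pruferChar p ω (-y) ∂μ with hI
  set g : ℕ → ℂ := fun i => (p : ℂ) / (((p : ℂ) + 1) * ((p : ℂ) ^ i) ^ 2) with hg
  have hstep (n : ℕ) : I (j + n) - g (j + n) = I j - g j := by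
    induction n with
    | zero => rfl
    | succ n ih =>
      rw [← ih]
      have h := setIntegral_norm_mul_pruferChar_neg_succ μ hm (j + n)
      rw [setIntegral_pruferChar_neg_of_le μ hm (by lia : m ≤ j + n),
        setIntegral_pruferChar_neg_of_le μ hm (by lia : m ≤ j + n + 1)] at h
      change I (j + n) = I (j + n + 1) + _ at h
      rw [h, ← add_assoc]
      simp only [hg, pow_succ (p : ℂ) (j + n)]
      have := pow_ne_zero (j + n) hp0
      field_simp
      ring
  have hgr : Tendsto g atTop (nhds 0) := by
    have hlim : Tendsto (fun i : ℕ => ((p : ℂ) ^ i)⁻¹) atTop (nhds 0) := by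
      simp_rw [← inv_pow]
      refine tendsto_pow_atTop_nhds_zero_of_norm_lt_one ?_
      simpa using inv_lt_one_of_one_lt₀ hp
    have := ((hlim.pow 2).const_mul ((p : ℂ) / (p + 1)))
    simp only [ne_eq, OfNat.ofNat_ne_zero, not_false_eq_true, zero_pow, mul_zero] at this
    refine this.congr fun i => ?_
    simp only [hg]
    field_simp
  have hlim : Tendsto (fun n => I (j + n) - g (j + n)) atTop (nhds 0) := by
    have h := (tendsto_setIntegral_norm_mul_pruferChar_neg μ hm).sub hgr
    rw [sub_zero] at h
    exact h.comp (tendsto_atTop_mono (fun n => Nat.le_add_left n j) tendsto_id)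
  simp_rw [hstep] at hlim
  exact sub_eq_zero.mp (tendsto_nhds_unique tendsto_const_nhds hlim)

theorem setIntegral_norm_mul_pruferChar_neg_of_lt (hm : orderOf ω = p ^ m) {j : ℕ} (hj : j < m) :
    ∫ y in zeroBall p j, (‖y‖ : ℂ) * pruferChar p ω (-y) ∂μ =
      -((p : ℂ) ^ 2 / (((p : ℂ) + 1) * ((p : ℂ) ^ m) ^ 2)) := by
  have hp0 : (p : ℂ) ≠ 0 := by exact_mod_cast (Fact.out : p.Prime).ne_zero
  have hp1 : (p : ℂ) + 1 ≠ 0 := by exact_mod_cast p.succ_ne_zero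
  obtain ⟨n, rfl⟩ := Nat.exists_eq_add_of_lt hj
  induction n generalizing j with
  | zero =>
    rw [setIntegral_norm_mul_pruferChar_neg_succ μ hm, setIntegral_pruferChar_neg_of_lt μ hm hj,
      setIntegral_pruferChar_neg_of_le μ hm le_rfl,
      setIntegral_norm_mul_pruferChar_neg_of_le μ hm le_rfl]
    simp only [add_zero, pow_succ (p : ℂ) j]
    have := pow_ne_zero j hp0
    field_simp
    ring
  | succ n ih =>
    rw [setIntegral_norm_mul_pruferChar_neg_succ μ hm, setIntegral_pruferChar_neg_of_lt μ hm hj,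
      setIntegral_pruferChar_neg_of_lt μ hm (by lia), sub_zero, mul_zero, add_zero]
    have e : j + (n + 1) + 1 = j + 1 + n + 1 := by lia
    rw [e] at hm ⊢
    exact ih hm (by lia)

end Integral

/-- For `R = p^{-k}` (`k ≥ 1`) and `ω ∈ ℤ(p^∞)` with `‖ω‖ > p^k = 1/R`:
`∫_{|y| ≤ R} |y| ω^{-y} dμ(y) = -p² / ((p + 1) ‖ω‖²)`. -/
theorem integral_large_order (p : ℕ) [Fact p.Prime] (μ : Measure ℤ_[p])
    [μ.IsAddHaarMeasure] [IsProbabilityMeasure μ]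
    (k : ℕ) (hk : 1 ≤ k) (ω : ℂ) (hω : ω ∈ prufer p) (hord : p ^ k < orderOf ω) :
    ∫ y in {y : ℤ_[p] | ‖y‖ ≤ (p : ℝ) ^ (-(k : ℤ))},
        (‖y‖ : ℂ) * pruferChar p ω (-y) ∂μ
      = -((p : ℂ) ^ 2 / (((p : ℂ) + 1) * (orderOf ω : ℂ) ^ 2)) := by
  obtain ⟨m, hm⟩ := exists_orderOf_eq_of_mem_prufer hω
  have hkm : k < m := (Nat.pow_lt_pow_iff_right (Fact.out : p.Prime).one_lt).mp (hm ▸ hord)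
  rw [hm, Nat.cast_pow]
  exact setIntegral_norm_mul_pruferChar_neg_of_lt μ hm hkm
end
end
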